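/- arXiv:1010.4497 — 2 statements merged into one kernel-verified Lean document; each statement's English description precedes it below -/
import Mathlib

section
/- Let M = (V, D) be a proper set system. Then D is the family of independent sets of a matroid on ground set V if and only if both (1) D is downward closed, i.e., for each Y ∈ D and Y' ⊆ Y we have Y' ∈ D, and (2) for each X ⊆ V, the family of inclusion-minimal sets of M*X is equicardinal. -/
open scoped symmDiff

variable {V : Type*} [DecidableEq V] [Fintype V]

/-- Distance from `X` to the set system with family `D`. -/
noncomputable def dSS (D : Set (Finset V)) (X : Finset V) : ℕ :=
  sInf ((fun Y => (X ∆ Y).card) '' D)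

/-- Pivot (twist) of a set-system family on `X`. -/
def pivotSS (D : Set (Finset V)) (X : Finset V) : Set (Finset V) :=
  (fun Y => Y ∆ X) '' D

/-- Loop complementation on `v`. -/
def lcSS (D : Set (Finset V)) (v : V) : Set (Finset V) :=
  D ∆ ((fun Z => Z ∪ {v}) '' {Z ∈ D | v ∉ Z})

/-- Dual pivot on `v`. -/
def dpSS (D : Set (Finset V)) (v : V) : Set (Finset V) :=
  D ∆ ((fun Z => Z \ {v}) '' {Z ∈ D | v ∈ Z})

/-- Delta-matroid: proper set system with the symmetric exchange axiom. -/
def DeltaMatroid (D : Set (Finset V)) : Prop :=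
  D.Nonempty ∧ ∀ X ∈ D, ∀ Y ∈ D, ∀ u ∈ X ∆ Y, ∃ v ∈ X ∆ Y, X ∆ {u, v} ∈ D

/-- Inclusion-minimal members. -/
def minFam (D : Set (Finset V)) : Set (Finset V) :=
  {X ∈ D | ∀ Y ∈ D, Y ⊆ X → Y = X}

/-- Inclusion-maximal members. -/
def maxFam (D : Set (Finset V)) : Set (Finset V) :=
  {X ∈ D | ∀ Y ∈ D, X ⊆ Y → Y = X}

/-- Members of minimum cardinality. -/
def minCardFam (D : Set (Finset V)) : Set (Finset V) :=
  {X ∈ D | ∀ Y ∈ D, X.card ≤ Y.card}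

/-- Members of maximum cardinality. -/
def maxCardFam (D : Set (Finset V)) : Set (Finset V) :=
  {X ∈ D | ∀ Y ∈ D, Y.card ≤ X.card}

/-- All members have the same cardinality. -/
def Equicardinal (F : Set (Finset V)) : Prop :=
  ∀ X ∈ F, ∀ Y ∈ F, X.card = Y.card

/-- Restriction of the family to subsets of `X`. -/
def restrictSS (D : Set (Finset V)) (X : Finset V) : Set (Finset V) :=
  {Y ∈ D | Y ⊆ X}

/-- For a downward closed family, the minimal members of the pivot on `X` are the complements
in `X` of the maximal members contained in `X`. -/
lemma mem_minFam_pivotSS_iff {D : Set (Finset V)} (hdown : ∀ Y ∈ D, ∀ Y' ⊆ Y, Y' ∈ D)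
    {X Z : Finset V} :
    Z ∈ minFam (pivotSS D X) ↔ ∃ Y, Maximal (fun Y => Y ∈ D ∧ Y ⊆ X) Y ∧ X \ Y = Z := by
  have key : ∀ Y, Y ⊆ X → Y ∆ X = X \ Y := fun Y h => symmDiff_of_le h
  constructor
  · rintro ⟨⟨Y, hY, rfl⟩, hmin⟩
    have hYX : Y ⊆ X := by
      have h := hmin ((Y ∩ X) ∆ X) ⟨_, hdown Y hY _ Finset.inter_subset_left, rfl⟩
        (by intro a; simp only [Finset.mem_symmDiff, Finset.mem_inter]; tauto)
      exact Finset.inter_eq_left.1 (symmDiff_left_injective X h)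
    refine ⟨Y, ⟨⟨hY, hYX⟩, fun W hW hYW => ?_⟩, (key Y hYX).symm⟩
    have h := hmin (W ∆ X) ⟨W, hW.1, rfl⟩ (by
      change W ∆ X ⊆ Y ∆ X
      rw [key W hW.2, key Y hYX]
      exact Finset.sdiff_subset_sdiff subset_rfl hYW)
    exact (symmDiff_left_injective X h).le
  · rintro ⟨Y, ⟨⟨hY, hYX⟩, hmax⟩, rfl⟩
    refine ⟨⟨Y, hY, key Y hYX⟩, ?_⟩
    rintro _ ⟨W, hW, rfl⟩ hsub
    change W ∆ X ⊆ X \ Y at hsub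
    have hWX : W ⊆ X := fun a ha => by
      by_contra hX
      exact hX (Finset.mem_sdiff.1 (hsub (Finset.mem_symmDiff.2 (Or.inl ⟨ha, hX⟩)))).1
    have hYW : Y ⊆ W := fun a ha => by
      by_contra h
      exact (Finset.mem_sdiff.1 (hsub (Finset.mem_symmDiff.2 (Or.inr ⟨hYX ha, h⟩)))).2 ha
    change W ∆ X = X \ Y
    rw [key W hWX, (hmax ⟨hW, hWX⟩ hYW).antisymm hYW]

/-- For a downward closed family, the minimal members of the pivot on `X` are equicardinal iff
the maximal members contained in `X` are. -/
lemma equicardinal_minFam_pivotSS_iff {D : Set (Finset V)}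
    (hdown : ∀ Y ∈ D, ∀ Y' ⊆ Y, Y' ∈ D) {X : Finset V} :
    Equicardinal (minFam (pivotSS D X)) ↔
      Equicardinal {Y | Maximal (fun Y => Y ∈ D ∧ Y ⊆ X) Y} := by
  have hcard : ∀ I J : Finset V, I ⊆ X → J ⊆ X → ((X \ I).card = (X \ J).card ↔
      I.card = J.card) := fun I J hI hJ => by
    have := Finset.card_sdiff_add_card_eq_card hI
    have := Finset.card_sdiff_add_card_eq_card hJ
    omega
  constructor
  · intro h I hI J hJ
    exact (hcard I J hI.1.2 hJ.1.2).1 (h _ ((mem_minFam_pivotSS_iff hdown).2 ⟨I, hI, rfl⟩) _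
      ((mem_minFam_pivotSS_iff hdown).2 ⟨J, hJ, rfl⟩))
  · intro h A hA B hB
    obtain ⟨I, hI, rfl⟩ := (mem_minFam_pivotSS_iff hdown).1 hA
    obtain ⟨J, hJ, rfl⟩ := (mem_minFam_pivotSS_iff hdown).1 hB
    exact (hcard I J hI.1.2 hJ.1.2).2 (h I hI J hJ)

/-- `D` is the family of independent sets of a matroid on ground
set `V` iff `D` is downward closed and for each `X` the inclusion-minimal sets
of `M*X` are equicardinal. -/
theorem matroid_indep_iff (D : Set (Finset V)) (hD : D.Nonempty) :
    (∃ M : Matroid V, M.E = Set.univ ∧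
        ∀ I : Set V, M.Indep I ↔ ∃ Y ∈ D, (Y : Set V) = I) ↔
      ((∀ Y ∈ D, ∀ Y' ⊆ Y, Y' ∈ D) ∧
        ∀ X : Finset V, Equicardinal (minFam (pivotSS D X))) := by
  constructor
  · rintro ⟨M, hE, hM⟩
    have hmem : ∀ Y : Finset V, M.Indep Y ↔ Y ∈ D := fun Y => by simp [hM]
    have hdown : ∀ Y ∈ D, ∀ Y' ⊆ Y, Y' ∈ D := fun Y hY Y' h =>
      (hmem Y').1 (((hmem Y).2 hY).subset (Finset.coe_subset.2 h))
    refine ⟨hdown, fun X => (equicardinal_minFam_pivotSS_iff hdown).2 ?_⟩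
    have hbasis : ∀ I, Maximal (fun Y => Y ∈ D ∧ Y ⊆ X) I → M.IsBasis (I : Set V) X := by
      rintro I ⟨⟨hI, hIX⟩, hmax⟩
      refine (Matroid.isBasis_iff (by simp [hE])).2
        ⟨(hmem I).2 hI, Finset.coe_subset.2 hIX, fun J hJ hIJ hJX => ?_⟩
      obtain ⟨J, hJD, rfl⟩ := (hM J).1 hJ
      rw [Finset.coe_subset] at hIJ hJX
      rw [hIJ.antisymm (hmax ⟨hJD, hJX⟩ hIJ)]
    intro I hI J hJ
    simpa using (hbasis I hI).encard_eq_encard (hbasis J hJ)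
  · rintro ⟨hdown, hequi⟩
    obtain ⟨Y₀, hY₀⟩ := hD
    refine ⟨(IndepMatroid.ofFinset Set.univ (· ∈ D) (hdown Y₀ hY₀ ∅ (Finset.empty_subset _))
      (fun I J hJ hIJ => hdown J hJ I hIJ) (fun I J hI hJ hlt => ?_)
      (fun I _ => Set.subset_univ _)).matroid, rfl, fun I => ?_⟩
    · by_contra! hno
      have hImax : Maximal (fun Y => Y ∈ D ∧ Y ⊆ I ∪ J) I := by
        refine ⟨⟨hI, Finset.subset_union_left⟩, fun W hW hIW a ha => ?_⟩
        by_contra haI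
        exact hno a ((Finset.mem_union.1 (hW.2 ha)).resolve_left haI) haI
          (hdown W hW.1 _ (Finset.insert_subset ha hIW))
      obtain ⟨K, hJK, hK⟩ := (Set.toFinite {Y | Y ∈ D ∧ Y ⊆ I ∪ J}).exists_le_maximal
        (a := J) ⟨hJ, Finset.subset_union_right⟩
      have := (equicardinal_minFam_pivotSS_iff hdown).1 (hequi (I ∪ J)) I hImax K hK
      have := Finset.card_le_card hJK
      omega
    · lift I to Finset V using Set.toFinite I
      simp
end

section
/- Let G be a symmetric V × V matrix over GF(2) (a graph with loops allowed) and let M_G = (V, {X ⊆ V : G[X] is nonsingular}). Let φ be any finite sequence of operations on set systems over V, each operation being either a pivot *u or a loop complementation +u on a single element u ∈ V. Then there exist a symmetric V × V matrix G' over GF(2) and a set X ⊆ V such that M_G φ = M_{G'} * X. In particular, M_G φ is a delta-matroid, so M_G is vertex-flip-closed. -/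
open scoped symmDiff

variable {V : Type*} [DecidableEq V] [Fintype V]

/-- A single vertex flip: `(true, u)` is the pivot `*u`, `(false, u)` is the
loop complementation `+u`. -/
def applyOp (D : Set (Finset V)) (p : Bool × V) : Set (Finset V) :=
  if p.1 then pivotSS D {p.2} else lcSS D p.2

/-- Apply a finite sequence of single-element pivots and loop complementations. -/
def applySeq (D : Set (Finset V)) (φ : List (Bool × V)) : Set (Finset V) :=
  φ.foldl applyOp D

/-- The set system `M_G` of a matrix over GF(2): the sets indexing nonsingular
principal submatrices. -/
def matSS (G : Matrix V V (ZMod 2)) : Set (Finset V) :=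
  {X : Finset V | (G.submatrix (fun i : X => (i : V)) (fun i : X => (i : V))).det ≠ 0}

/-- The matrix with the columns of `A` on `X` and the columns of `B` off `X`. -/
def colSelect (A B : Matrix V V (ZMod 2)) (X : Finset V) : Matrix V V (ZMod 2) :=
  Matrix.of fun i j => if j ∈ X then A i j else B i j

/-- The set system of the pair `(A, B)`: the column selections that are nonsingular. -/
def pairSS (A B : Matrix V V (ZMod 2)) : Set (Finset V) :=
  {X | (colSelect A B X).det ≠ 0}

omit [Fintype V] in
theorem mem_pivotSS {D : Set (Finset V)} {X Z : Finset V} : X ∈ pivotSS D Z ↔ X ∆ Z ∈ D := by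
  constructor
  · rintro ⟨Y, hY, rfl⟩
    simpa using hY
  · exact fun h => ⟨X ∆ Z, h, by simp⟩

omit [Fintype V] in
theorem pivotSS_pivotSS (D : Set (Finset V)) (X : Finset V) : pivotSS (pivotSS D X) X = D := by
  ext Y
  simp [mem_pivotSS]

omit [Fintype V] in
theorem mem_lcSS_of_notMem {D : Set (Finset V)} {X : Finset V} {u : V} (hu : u ∉ X) :
    X ∈ lcSS D u ↔ X ∈ D := by
  simp only [lcSS, Set.mem_symmDiff, Set.mem_image, Set.mem_ofPred_eq]
  have h : ¬ ∃ Z, (Z ∈ D ∧ u ∉ Z) ∧ Z ∪ {u} = X := by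
    rintro ⟨Z, -, rfl⟩
    simp at hu
  simp only [h, not_false_eq_true, and_true, false_and, or_false]

omit [Fintype V] in
theorem mem_lcSS_of_mem {D : Set (Finset V)} {X : Finset V} {u : V} (hu : u ∈ X) :
    X ∈ lcSS D u ↔ Xor (X ∈ D) (X.erase u ∈ D) := by
  simp only [lcSS, Set.mem_symmDiff, Set.mem_image, Set.mem_ofPred_eq, Xor]
  have h : (∃ Z, (Z ∈ D ∧ u ∉ Z) ∧ Z ∪ {u} = X) ↔ X.erase u ∈ D := by
    constructor
    · rintro ⟨Z, ⟨hZ, hu'⟩, rfl⟩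
      rwa [Finset.union_comm, ← Finset.insert_eq, Finset.erase_insert hu']
    · intro h
      refine ⟨X.erase u, ⟨h, Finset.notMem_erase u X⟩, ?_⟩
      rw [Finset.union_comm, ← Finset.insert_eq, Finset.insert_erase hu]
  rw [h]

omit [Fintype V] in
theorem lcSS_nonempty {D : Set (Finset V)} (hD : D.Nonempty) (u : V) : (lcSS D u).Nonempty := by
  by_cases h : ∃ Z ∈ D, u ∉ Z
  · obtain ⟨Z, hZ, hu⟩ := h
    exact ⟨Z, (mem_lcSS_of_notMem hu).2 hZ⟩
  · push Not at h
    obtain ⟨X, hX⟩ := hD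
    exact ⟨X, (mem_lcSS_of_mem (h X hX)).2
      (Or.inl ⟨hX, fun h' => Finset.notMem_erase u X (h _ h')⟩)⟩

theorem matSS_eq_pairSS (G : Matrix V V (ZMod 2)) : matSS G = pairSS G 1 := by
  ext X
  have h : (colSelect G 1 X).det =
      (G.submatrix (fun i : X => (i : V)) (fun i : X => (i : V))).det := by
    rw [Matrix.twoBlockTriangular_det' _ (· ∈ X)]
    · have h₁ : Matrix.toSquareBlockProp (colSelect G 1 X) (· ∈ X) =
          G.submatrix (fun i : X => (i : V)) (fun i : X => (i : V)) := by
        ext i j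
        simp [colSelect, Matrix.toSquareBlockProp_def]
      have h₂ : Matrix.toSquareBlockProp (colSelect G 1 X) (· ∉ X) = 1 := by
        ext i j
        simp [colSelect, Matrix.toSquareBlockProp_def, j.2, Matrix.one_apply, Subtype.ext_iff]
      rw [h₁, h₂, Matrix.det_one, mul_one]
      congr!
    · intro i hi j hj
      simp only [colSelect, Matrix.of_apply, if_neg hj]
      exact Matrix.one_apply_ne fun hij => hj (hij ▸ hi)
  simp only [matSS, pairSS, Set.mem_ofPred_eq, h]

theorem pivotSS_pairSS (A B : Matrix V V (ZMod 2)) (Z : Finset V) :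
    pivotSS (pairSS A B) Z = pairSS (colSelect B A Z) (colSelect A B Z) := by
  ext X
  rw [mem_pivotSS]
  have h : colSelect A B (X ∆ Z) = colSelect (colSelect B A Z) (colSelect A B Z) X := by
    ext i j
    by_cases h₁ : j ∈ X <;> by_cases h₂ : j ∈ Z <;>
      simp [colSelect, Finset.mem_symmDiff, h₁, h₂]
  simp only [pairSS, Set.mem_ofPred_eq, h]

theorem colSelect_isotropic {A B : Matrix V V (ZMod 2)} (h : A * B.transpose = B * A.transpose)
    (Z : Finset V) :
    colSelect B A Z * (colSelect A B Z).transpose =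
      colSelect A B Z * (colSelect B A Z).transpose := by
  ext i k
  have hik := congrFun (congrFun h i) k
  simp only [Matrix.mul_apply, Matrix.transpose_apply] at hik ⊢
  rw [← sub_eq_zero, ← Finset.sum_sub_distrib] at hik ⊢
  rw [← hik]
  refine Finset.sum_congr rfl fun j _ => ?_
  by_cases hj : j ∈ Z <;> simp only [colSelect, Matrix.of_apply, hj, if_true, if_false]
  rw [← neg_sub, CharTwo.neg_eq]

theorem lcSS_pairSS (A B : Matrix V V (ZMod 2)) (u : V) :
    lcSS (pairSS A B) u = pairSS (A.updateCol u fun i => A i u + B i u) B := by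
  ext X
  by_cases hu : u ∈ X
  · have h : (colSelect (A.updateCol u fun i => A i u + B i u) B X).det =
        (colSelect A B X).det + (colSelect A B (X.erase u)).det := by
      have h₀ : colSelect (A.updateCol u fun i => A i u + B i u) B X =
          (colSelect A B X).updateCol u ((fun i => A i u) + fun i => B i u) := by
        ext i j
        by_cases hj : j = u
        · subst hj; simp [colSelect, hu]
        · simp [colSelect, hj]
      have h₁ : (colSelect A B X).updateCol u (fun i => A i u) = colSelect A B X := by
        ext i j
        by_cases hj : j = u
        · subst hj; simp [colSelect, hu]
        · simp [colSelect, hj]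
      have h₂ : (colSelect A B X).updateCol u (fun i => B i u) = colSelect A B (X.erase u) := by
        ext i j
        by_cases hj : j = u
        · subst hj; simp [colSelect]
        · simp [colSelect, hj]
      rw [h₀, Matrix.det_updateCol_add, h₁, h₂]
    rw [mem_lcSS_of_mem hu]
    simp only [pairSS, Set.mem_ofPred_eq, h]
    generalize (colSelect A B X).det = a
    generalize (colSelect A B (X.erase u)).det = b
    revert a b
    unfold Xor
    decide
  · have h : colSelect (A.updateCol u fun i => A i u + B i u) B X = colSelect A B X := by
      ext i j
      by_cases hj : j = u
      · subst hj; simp [colSelect, hu]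
      · simp [colSelect, hj]
    rw [mem_lcSS_of_notMem hu]
    simp only [pairSS, Set.mem_ofPred_eq, h]

theorem updateCol_isotropic {A B : Matrix V V (ZMod 2)} (h : A * B.transpose = B * A.transpose)
    (u : V) :
    (A.updateCol u fun i => A i u + B i u) * B.transpose =
      B * (A.updateCol u fun i => A i u + B i u).transpose := by
  ext i k
  have hik := congrFun (congrFun h i) k
  simp only [Matrix.mul_apply, Matrix.transpose_apply] at hik ⊢
  rw [← sub_eq_zero, ← Finset.sum_sub_distrib] at hik ⊢
  rw [← hik]
  refine Finset.sum_congr rfl fun j _ => ?_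
  by_cases hj : j = u
  · subst hj
    simp only [Matrix.updateCol_self]
    ring
  · simp only [Matrix.updateCol_ne hj]

theorem exists_pairSS_eq_matSS {A B : Matrix V V (ZMod 2)}
    (h : A * B.transpose = B * A.transpose) (hB : B.det ≠ 0) :
    ∃ G : Matrix V V (ZMod 2), G.IsSymm ∧ pairSS A B = matSS G := by
  have hu : IsUnit B.det := hB.isUnit
  have hut : IsUnit B.transpose.det := by rwa [Matrix.det_transpose]
  refine ⟨B⁻¹ * A, ?_, ?_⟩
  · calc (B⁻¹ * A).transpose = A.transpose * B.transpose⁻¹ := by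
          rw [Matrix.transpose_mul, Matrix.transpose_nonsing_inv]
      _ = B⁻¹ * (B * A.transpose) * B.transpose⁻¹ := by
          rw [Matrix.nonsing_inv_mul_cancel_left _ _ hu]
      _ = B⁻¹ * A := by
          rw [← h, ← Matrix.mul_assoc, Matrix.mul_nonsing_inv_cancel_right _ _ hut]
  · rw [matSS_eq_pairSS]
    ext X
    have hX : colSelect A B X = B * colSelect (B⁻¹ * A) 1 X := by
      have hA : A = B * (B⁻¹ * A) := (Matrix.mul_nonsing_inv_cancel_left _ _ hu).symm
      ext i j
      by_cases hj : j ∈ X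
      · simpa [colSelect, hj, Matrix.mul_apply] using congrFun (congrFun hA i) j
      · simp [colSelect, hj, Matrix.mul_apply, Matrix.one_apply]
    simp only [pairSS, Set.mem_ofPred_eq, hX, Matrix.det_mul, mul_ne_zero_iff, hB, ne_eq,
      not_false_eq_true, true_and]

theorem exists_pivotSS_eq_matSS {A B : Matrix V V (ZMod 2)}
    (h : A * B.transpose = B * A.transpose) {X : Finset V} (hX : X ∈ pairSS A B) :
    ∃ G : Matrix V V (ZMod 2), G.IsSymm ∧ pivotSS (pairSS A B) X = matSS G := by
  rw [pivotSS_pairSS]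
  exact exists_pairSS_eq_matSS (colSelect_isotropic h X) hX

omit [Fintype V] in
theorem empty_mem_matSS (G : Matrix V V (ZMod 2)) : ∅ ∈ matSS G := by
  simp [matSS]

omit [Fintype V] in
theorem exists_pair_mem_matSS {G : Matrix V V (ZMod 2)} (hG : G.IsSymm) {Y : Finset V}
    (hY : Y ∈ matSS G) {u : V} (hu : u ∈ Y) : ∃ v ∈ Y, {u, v} ∈ matSS G := by
  by_cases huu : G u u = 0
  · obtain ⟨v, hv, huv⟩ : ∃ v ∈ Y, G u v ≠ 0 := by
      by_contra! h
      exact hY (Matrix.det_eq_zero_of_row_eq_zero ⟨u, hu⟩ fun j => h j j.2)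
    refine ⟨v, hv, fun hdet => ?_⟩
    have hne : u ≠ v := by
      rintro rfl
      exact huv huu
    obtain ⟨x, hx, hGx⟩ := Matrix.exists_mulVec_eq_zero_iff.2 hdet
    have key : ∀ i : ({u, v} : Finset V),
        G i u * x ⟨u, by simp⟩ + G i v * x ⟨v, by simp⟩ = 0 := by
      intro i
      refine (Fintype.sum_eq_add (⟨u, by simp⟩ : ({u, v} : Finset V)) ⟨v, by simp⟩
        (by simpa using hne) ?_).symm.trans (congrFun hGx i)
      rintro ⟨j, hj⟩ ⟨hju, hjv⟩
      rcases Finset.mem_insert.1 hj with rfl | hj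
      · exact absurd rfl hju
      · obtain rfl := Finset.mem_singleton.1 hj
        exact absurd rfl hjv
    have hxv : x ⟨v, by simp⟩ = 0 := by
      simpa [huu, huv] using key ⟨u, by simp⟩
    have hxu : x ⟨u, by simp⟩ = 0 := by
      simpa [hxv, hG.apply u v, huv] using key ⟨v, by simp⟩
    apply hx
    ext ⟨i, hi⟩
    rcases Finset.mem_insert.1 hi with rfl | hi
    · exact hxu
    · obtain rfl := Finset.mem_singleton.1 hi
      exact hxv
  · refine ⟨u, hu, ?_⟩
    simp only [Finset.pair_eq_singleton, matSS, Set.mem_ofPred_eq]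
    rw [Matrix.det_eq_elem_of_subsingleton _ ⟨u, Finset.mem_singleton_self u⟩]
    exact huu

theorem deltaMatroid_pairSS {A B : Matrix V V (ZMod 2)}
    (h : A * B.transpose = B * A.transpose) (hne : (pairSS A B).Nonempty) :
    DeltaMatroid (pairSS A B) := by
  refine ⟨hne, fun X hX Y hY u hu => ?_⟩
  obtain ⟨G, hG, hXG⟩ := exists_pivotSS_eq_matSS h hX
  have hYG : X ∆ Y ∈ matSS G := by
    rw [← hXG, mem_pivotSS, symmDiff_comm X Y, symmDiff_symmDiff_cancel_right]
    exact hY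
  obtain ⟨v, hv, huv⟩ := exists_pair_mem_matSS hG hYG hu
  rw [← hXG, mem_pivotSS, symmDiff_comm] at huv
  exact ⟨v, hv, huv⟩

theorem exists_applySeq_eq_pairSS (φ : List (Bool × V)) {A B : Matrix V V (ZMod 2)}
    (h : A * B.transpose = B * A.transpose) (hne : (pairSS A B).Nonempty) :
    ∃ A' B' : Matrix V V (ZMod 2), A' * B'.transpose = B' * A'.transpose ∧
      (pairSS A' B').Nonempty ∧ applySeq (pairSS A B) φ = pairSS A' B' := by
  induction φ generalizing A B with
  | nil => exact ⟨A, B, h, hne, rfl⟩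
  | cons p φ ih =>
    obtain ⟨_ | _, u⟩ := p
    · have hop : applyOp (pairSS A B) (false, u) = _ := lcSS_pairSS A B u
      rw [applySeq, List.foldl_cons, hop]
      exact ih (updateCol_isotropic h u) (lcSS_pairSS A B u ▸ lcSS_nonempty hne u)
    · have hop : applyOp (pairSS A B) (true, u) = _ := pivotSS_pairSS A B {u}
      rw [applySeq, List.foldl_cons, hop]
      exact ih (colSelect_isotropic h {u}) (pivotSS_pairSS A B {u} ▸ hne.image _)

/-- for a graph `G`, any sequence `φ` of single-element pivots
and loop complementations applied to `M_G` yields a set system of the form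
`M_{G'} * X` for some graph `G'`; in particular `M_G φ` is a delta-matroid, so
`M_G` is vertex-flip-closed. -/
theorem matSS_vertex_flip_closed (G : Matrix V V (ZMod 2)) (hG : G.IsSymm)
    (φ : List (Bool × V)) :
    (∃ G' : Matrix V V (ZMod 2), G'.IsSymm ∧ ∃ X : Finset V,
      applySeq (matSS G) φ = pivotSS (matSS G') X) ∧
    DeltaMatroid (applySeq (matSS G) φ) := by
  have hne : (pairSS G 1).Nonempty := ⟨∅, matSS_eq_pairSS G ▸ empty_mem_matSS G⟩
  obtain ⟨A, B, h, ⟨X, hX⟩, hφ⟩ :=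
    exists_applySeq_eq_pairSS φ (A := G) (B := 1) (by simp [hG.eq]) hne
  rw [matSS_eq_pairSS, hφ]
  refine ⟨?_, deltaMatroid_pairSS h ⟨X, hX⟩⟩
  obtain ⟨G', hG', hXG⟩ := exists_pivotSS_eq_matSS h hX
  exact ⟨G', hG', X, by rw [← hXG, pivotSS_pivotSS]⟩
end
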